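/- A modal formula φ is completely additive in a propositional variable p over finite Kripke models if and only if φ is completely additive in p over all Kripke models. -/

import Mathlib

/-- Multi-modal formulas with modality labels from `A` and
propositional variables indexed by `ℕ`. -/
inductive MF (A : Type) : Type
  | bot : MF A
  | var : ℕ → MF A
  | neg : MF A → MF A
  | and : MF A → MF A → MF A
  | or : MF A → MF A → MF A
  | imp : MF A → MF A → MF A
  | dia : A → MF A → MF A
  | box : A → MF A → MF A

/-- Kripke models. -/
structure KModel (A : Type) where
  W : Type
  R : A → W → W → Prop
  V : ℕ → Set W

/-- `M[p ↦ X]`: change the valuation of variable `p` to `X`. -/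
def KModel.update {A : Type} (M : KModel A) (p : ℕ) (X : Set M.W) : KModel A :=
  ⟨M.W, M.R, fun q => if q = p then X else M.V q⟩

/-- Kripke semantics. -/
def MSat {A : Type} (M : KModel A) : M.W → MF A → Prop
  | _, .bot => False
  | w, .var p => w ∈ M.V p
  | w, .neg φ => ¬ MSat M w φ
  | w, .and φ ψ => MSat M w φ ∧ MSat M w ψ
  | w, .or φ ψ => MSat M w φ ∨ MSat M w ψ
  | w, .imp φ ψ => MSat M w φ → MSat M w ψ
  | w, .dia a φ => ∃ v, M.R a w v ∧ MSat M v φ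
  | w, .box a φ => ∀ v, M.R a w v → MSat M v φ

/-- Uniform substitution `φ[p/θ]`. -/
def substMF {A : Type} (p : ℕ) (θ : MF A) : MF A → MF A
  | .bot => .bot
  | .var q => if q = p then θ else .var q
  | .neg φ => .neg (substMF p θ φ)
  | .and φ ψ => .and (substMF p θ φ) (substMF p θ ψ)
  | .or φ ψ => .or (substMF p θ φ) (substMF p θ ψ)
  | .imp φ ψ => .imp (substMF p θ φ) (substMF p θ ψ)
  | .dia a φ => .dia a (substMF p θ φ)
  | .box a φ => .box a (substMF p θ φ)

/-- The set of propositional variables occurring in a formula. -/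
def varsMF {A : Type} : MF A → Set ℕ
  | .bot => ∅
  | .var q => {q}
  | .neg φ => varsMF φ
  | .and φ ψ => varsMF φ ∪ varsMF ψ
  | .or φ ψ => varsMF φ ∪ varsMF ψ
  | .imp φ ψ => varsMF φ ∪ varsMF ψ
  | .dia _ φ => varsMF φ
  | .box _ φ => varsMF φ

/-- Validity over all Kripke models. -/
def MValid {A : Type} (φ : MF A) : Prop :=
  ∀ (M : KModel A) (w : M.W), MSat M w φ

/-- Validity over all finite Kripke models. -/
def MValidFin {A : Type} (φ : MF A) : Prop :=
  ∀ (M : KModel A), Finite M.W → ∀ w : M.W, MSat M w φ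

/-- `φ` is monotone in `p` (over all Kripke models). -/
def MonotoneIn {A : Type} (φ : MF A) (p : ℕ) : Prop :=
  ∀ (M : KModel A) (w : M.W), MSat M w φ →
    ∀ X : Set M.W, M.V p ⊆ X → MSat (M.update p X) w φ

/-- `φ` is monotone in `p` over finite Kripke models. -/
def MonotoneInFin {A : Type} (φ : MF A) (p : ℕ) : Prop :=
  ∀ (M : KModel A), Finite M.W → ∀ w : M.W, MSat M w φ →
    ∀ X : Set M.W, M.V p ⊆ X → MSat (M.update p X) w φ

/-- `φ` is completely additive in `p` (over all Kripke models). -/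
def CompAdd {A : Type} (φ : MF A) (p : ℕ) : Prop :=
  MonotoneIn φ p ∧
    ∀ (M : KModel A) (w : M.W), MSat M w φ →
      ∃ v ∈ M.V p, MSat (M.update p {v}) w φ

/-- `φ` is completely additive in `p` over finite Kripke models. -/
def CompAddFin {A : Type} (φ : MF A) (p : ℕ) : Prop :=
  MonotoneInFin φ p ∧
    ∀ (M : KModel A), Finite M.W → ∀ w : M.W, MSat M w φ →
      ∃ v ∈ M.V p, MSat (M.update p {v}) w φ

/-! ### Syntactic measures -/

/-- The set of modality labels occurring in a formula. -/
def labelsMF {A : Type} : MF A → Set A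
  | .bot => ∅
  | .var _ => ∅
  | .neg φ => labelsMF φ
  | .and φ ψ => labelsMF φ ∪ labelsMF ψ
  | .or φ ψ => labelsMF φ ∪ labelsMF ψ
  | .imp φ ψ => labelsMF φ ∪ labelsMF ψ
  | .dia a φ => insert a (labelsMF φ)
  | .box a φ => insert a (labelsMF φ)

/-- The modal depth of a formula. -/
def depthMF {A : Type} : MF A → ℕ
  | .bot => 0
  | .var _ => 0
  | .neg φ => depthMF φ
  | .and φ ψ => max (depthMF φ) (depthMF ψ)
  | .or φ ψ => max (depthMF φ) (depthMF ψ)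
  | .imp φ ψ => max (depthMF φ) (depthMF ψ)
  | .dia _ φ => depthMF φ + 1
  | .box _ φ => depthMF φ + 1

theorem finite_labelsMF {A : Type} (φ : MF A) : (labelsMF φ).Finite := by
  induction φ <;> simp_all [labelsMF]

theorem finite_varsMF {A : Type} (φ : MF A) : (varsMF φ).Finite := by
  induction φ <;> simp_all [varsMF]

/-! ### Changing the valuation -/

theorem KModel.mem_update {A : Type} (M : KModel A) (p q : ℕ) (X : Set M.W) (x : M.W) :
    x ∈ (M.update p X).V q ↔ if q = p then x ∈ X else x ∈ M.V q := by
  simp only [KModel.update]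
  split <;> rfl

theorem msat_congr_val {A W : Type} {R : A → W → W → Prop} {V V' : ℕ → Set W} (h : V = V')
    (w : W) (φ : MF A) : MSat ⟨W, R, V⟩ w φ ↔ MSat ⟨W, R, V'⟩ w φ := by
  rw [h]

theorem msat_update_update {A : Type} (M : KModel A) (p : ℕ) (X Y : Set M.W) (w : M.W)
    (φ : MF A) : MSat ((M.update p X).update p Y) w φ ↔ MSat (M.update p Y) w φ := by
  refine msat_congr_val (funext fun q => ?_) w φ
  simp only [KModel.update]
  split <;> rfl

/-! ### Bounded bisimilarity -/

/-- `k`-step bisimilarity with respect to the labels in `L` and the variables in `S`. -/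
def Bisim {A : Type} (L : Set A) (S : Set ℕ) (M N : KModel A) : ℕ → M.W → N.W → Prop
  | 0, x, y => ∀ q ∈ S, (x ∈ M.V q ↔ y ∈ N.V q)
  | k + 1, x, y => (∀ q ∈ S, (x ∈ M.V q ↔ y ∈ N.V q)) ∧
      ∀ a ∈ L, (∀ x', M.R a x x' → ∃ y', N.R a y y' ∧ Bisim L S M N k x' y') ∧
        (∀ y', N.R a y y' → ∃ x', M.R a x x' ∧ Bisim L S M N k x' y')

namespace Bisim

variable {A : Type} {L : Set A} {S : Set ℕ} {M N P : KModel A}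

theorem val {k : ℕ} {x : M.W} {y : N.W} (h : Bisim L S M N k x y) :
    ∀ q ∈ S, (x ∈ M.V q ↔ y ∈ N.V q) := by
  cases k with
  | zero => exact h
  | succ k => exact h.1

theorem symm {k : ℕ} {x : M.W} {y : N.W} (h : Bisim L S M N k x y) :
    Bisim L S N M k y x := by
  induction k generalizing x y with
  | zero => exact fun q hq => (h q hq).symm
  | succ k ih =>
    refine ⟨fun q hq => (h.1 q hq).symm, fun a ha => ⟨fun y' hy => ?_, fun x' hx => ?_⟩⟩
    · obtain ⟨x', hx, hb⟩ := (h.2 a ha).2 y' hy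
      exact ⟨x', hx, ih hb⟩
    · obtain ⟨y', hy, hb⟩ := (h.2 a ha).1 x' hx
      exact ⟨y', hy, ih hb⟩

theorem trans {k : ℕ} {x : M.W} {y : N.W} {z : P.W} (h : Bisim L S M N k x y)
    (h' : Bisim L S N P k y z) : Bisim L S M P k x z := by
  induction k generalizing x y z with
  | zero => exact fun q hq => (h q hq).trans (h' q hq)
  | succ k ih =>
    refine ⟨fun q hq => (h.1 q hq).trans (h'.1 q hq),
      fun a ha => ⟨fun x' hx => ?_, fun z' hz => ?_⟩⟩
    · obtain ⟨y', hy, hb⟩ := (h.2 a ha).1 x' hx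
      obtain ⟨z', hz, hb'⟩ := (h'.2 a ha).1 y' hy
      exact ⟨z', hz, ih hb hb'⟩
    · obtain ⟨y', hy, hb'⟩ := (h'.2 a ha).2 z' hz
      obtain ⟨x', hx, hb⟩ := (h.2 a ha).2 y' hy
      exact ⟨x', hx, ih hb hb'⟩

theorem of_succ {k : ℕ} {x : M.W} {y : N.W} (h : Bisim L S M N (k + 1) x y) :
    Bisim L S M N k x y := by
  induction k generalizing x y with
  | zero => exact h.1
  | succ k ih =>
    refine ⟨h.1, fun a ha => ⟨fun x' hx => ?_, fun y' hy => ?_⟩⟩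
    · obtain ⟨y', hy, hb⟩ := (h.2 a ha).1 x' hx
      exact ⟨y', hy, ih hb⟩
    · obtain ⟨x', hx, hb⟩ := (h.2 a ha).2 y' hy
      exact ⟨x', hx, ih hb⟩

theorem mono {k n : ℕ} (hkn : k ≤ n) {x : M.W} {y : N.W} (h : Bisim L S M N n x y) :
    Bisim L S M N k x y := by
  induction hkn with
  | refl => exact h
  | step _ ih => exact ih h.of_succ

/-- Bounded bisimilarity survives making a variable false everywhere. -/
theorem update_empty (p : ℕ) {k : ℕ} {x : M.W} {y : N.W} (h : Bisim L S M N k x y) :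
    Bisim L S (M.update p ∅) (N.update p ∅) k x y := by
  have hval : ∀ {x : M.W} {y : N.W}, (∀ q ∈ S, (x ∈ M.V q ↔ y ∈ N.V q)) →
      ∀ q ∈ S, (x ∈ (M.update p ∅).V q ↔ y ∈ (N.update p ∅).V q) := by
    intro x y h q hq
    rw [KModel.mem_update, KModel.mem_update]
    split
    · exact Iff.rfl
    · exact h q hq
  induction k generalizing x y with
  | zero => exact hval h
  | succ k ih =>
    refine ⟨hval h.1, fun a ha => ⟨fun x' hx => ?_, fun y' hy => ?_⟩⟩
    · obtain ⟨y', hy, hb⟩ := (h.2 a ha).1 x' hx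
      exact ⟨y', hy, ih hb⟩
    · obtain ⟨x', hx, hb⟩ := (h.2 a ha).2 y' hy
      exact ⟨x', hx, ih hb⟩

/-- A family of relations satisfying the back and forth conditions is contained in
bounded bisimilarity. -/
theorem of_family (Z : ℕ → M.W → N.W → Prop)
    (hval : ∀ k x y, Z k x y → ∀ q ∈ S, (x ∈ M.V q ↔ y ∈ N.V q))
    (hforth : ∀ k x y, Z (k + 1) x y → ∀ a ∈ L, ∀ x', M.R a x x' →
      ∃ y', N.R a y y' ∧ Z k x' y')
    (hback : ∀ k x y, Z (k + 1) x y → ∀ a ∈ L, ∀ y', N.R a y y' →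
      ∃ x', M.R a x x' ∧ Z k x' y')
    {k : ℕ} {x : M.W} {y : N.W} (h : Z k x y) : Bisim L S M N k x y := by
  induction k generalizing x y with
  | zero => exact hval _ _ _ h
  | succ k ih =>
    refine ⟨hval _ _ _ h, fun a ha => ⟨fun x' hx => ?_, fun y' hy => ?_⟩⟩
    · obtain ⟨y', hy, hb⟩ := hforth k x y h a ha x' hx
      exact ⟨y', hy, ih hb⟩
    · obtain ⟨x', hx, hb⟩ := hback k x y h a ha y' hy
      exact ⟨x', hx, ih hb⟩

/-- Modal formulas are invariant under bisimilarity up to their depth. -/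
theorem msat_iff {φ : MF A} {k : ℕ} (hd : depthMF φ ≤ k) (hL : labelsMF φ ⊆ L)
    (hS : varsMF φ ⊆ S) {x : M.W} {y : N.W} (h : Bisim L S M N k x y) :
    MSat M x φ ↔ MSat N y φ := by
  induction φ generalizing k x y with
  | bot => exact Iff.rfl
  | var q => exact h.val q (hS rfl)
  | neg φ ih => exact not_congr (ih hd hL hS h)
  | and φ ψ ih₁ ih₂ =>
    exact and_congr
      (ih₁ (le_of_max_le_left hd) (Set.subset_union_left.trans hL)
        (Set.subset_union_left.trans hS) h)
      (ih₂ (le_of_max_le_right hd) (Set.subset_union_right.trans hL)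
        (Set.subset_union_right.trans hS) h)
  | or φ ψ ih₁ ih₂ =>
    exact or_congr
      (ih₁ (le_of_max_le_left hd) (Set.subset_union_left.trans hL)
        (Set.subset_union_left.trans hS) h)
      (ih₂ (le_of_max_le_right hd) (Set.subset_union_right.trans hL)
        (Set.subset_union_right.trans hS) h)
  | imp φ ψ ih₁ ih₂ =>
    exact imp_congr
      (ih₁ (le_of_max_le_left hd) (Set.subset_union_left.trans hL)
        (Set.subset_union_left.trans hS) h)
      (ih₂ (le_of_max_le_right hd) (Set.subset_union_right.trans hL)
        (Set.subset_union_right.trans hS) h)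
  | dia a φ ih =>
    obtain ⟨k, rfl⟩ : ∃ j, k = j + 1 := ⟨k - 1, by simp only [depthMF] at hd; omega⟩
    have hd' : depthMF φ ≤ k := Nat.le_of_succ_le_succ hd
    have hL' : labelsMF φ ⊆ L := (Set.subset_insert _ _).trans hL
    obtain ⟨hf, hb⟩ := h.2 a (hL (Set.mem_insert _ _))
    constructor
    · rintro ⟨x', hx, hs⟩
      obtain ⟨y', hy, hxy⟩ := hf x' hx
      exact ⟨y', hy, (ih hd' hL' hS hxy).1 hs⟩
    · rintro ⟨y', hy, hs⟩
      obtain ⟨x', hx, hxy⟩ := hb y' hy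
      exact ⟨x', hx, (ih hd' hL' hS hxy).2 hs⟩
  | box a φ ih =>
    obtain ⟨k, rfl⟩ : ∃ j, k = j + 1 := ⟨k - 1, by simp only [depthMF] at hd; omega⟩
    have hd' : depthMF φ ≤ k := Nat.le_of_succ_le_succ hd
    have hL' : labelsMF φ ⊆ L := (Set.subset_insert _ _).trans hL
    obtain ⟨hf, hb⟩ := h.2 a (hL (Set.mem_insert _ _))
    constructor
    · intro hs y' hy
      obtain ⟨x', hx, hxy⟩ := hb y' hy
      exact (ih hd' hL' hS hxy).1 (hs x' hx)
    · intro hs x' hx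
      obtain ⟨y', hy, hxy⟩ := hf x' hx
      exact (ih hd' hL' hS hxy).2 (hs y' hy)

end Bisim

/-- For finite vocabularies, bounded bisimilarity has finite index. -/
theorem exists_finite_coloring {A : Type} {L : Set A} {S : Set ℕ} (hL : L.Finite)
    (hS : S.Finite) (M : KModel A) (k : ℕ) :
    ∃ (C : Type) (_ : Finite C) (c : M.W → C), ∀ x y, c x = c y → Bisim L S M M k x y := by
  have := hL.to_subtype
  have := hS.to_subtype
  have hval : ∀ {x y : M.W}, {q : S | x ∈ M.V q} = {q : S | y ∈ M.V q} →
      ∀ q ∈ S, (x ∈ M.V q ↔ y ∈ M.V q) := by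
    intro x y h q hq
    exact Set.ext_iff.1 h ⟨q, hq⟩
  induction k with
  | zero => exact ⟨Set S, inferInstance, fun x => {q | x ∈ M.V q}, fun x y h => hval h⟩
  | succ k ih =>
    obtain ⟨C, _, c, hc⟩ := ih
    refine ⟨Set S × Set (L × C), inferInstance,
      fun x => ({q | x ∈ M.V q}, {e | ∃ x', M.R e.1 x x' ∧ c x' = e.2}), fun x y h => ?_⟩
    obtain ⟨h₁, h₂⟩ := Prod.mk.inj h
    refine ⟨hval h₁, fun a ha => ⟨fun x' hx => ?_, fun y' hy => ?_⟩⟩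
    · obtain ⟨y', hy, e⟩ := (Set.ext_iff.1 h₂ (⟨a, ha⟩, c x')).1 ⟨x', hx, rfl⟩
      exact ⟨y', hy, hc _ _ e.symm⟩
    · obtain ⟨x', hx, e⟩ := (Set.ext_iff.1 h₂ (⟨a, ha⟩, c y')).2 ⟨y', hy, rfl⟩
      exact ⟨x', hx, hc _ _ e⟩

/-! ### Image models -/

/-- The least model making `c` a homomorphism. -/
def KModel.image {A : Type} (M : KModel A) {C : Type} (c : M.W → C) : KModel A :=
  ⟨C, fun a s t => ∃ x y, c x = s ∧ c y = t ∧ M.R a x y, fun q => c '' M.V q⟩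

theorem msat_image_update {A : Type} (M : KModel A) {C : Type} (c : M.W → C) (p : ℕ)
    (X : Set M.W) (s : C) (φ : MF A) :
    MSat ((M.update p X).image c) s φ ↔ MSat ((M.image c).update p (c '' X)) s φ := by
  refine msat_congr_val (funext fun q => ?_) s φ
  simp only [KModel.image, KModel.update]
  split <;> rfl

theorem bisim_image {A : Type} {L : Set A} {S : Set ℕ} {M : KModel A} {C : Type}
    {c : M.W → C} {n : ℕ} (hc : ∀ x y, c x = c y → Bisim L S M M n x y) {k : ℕ} (hk : k ≤ n)
    (x : M.W) : Bisim L S M (M.image c) k x (c x) := by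
  have hval : ∀ x : M.W, ∀ q ∈ S, (x ∈ M.V q ↔ c x ∈ (M.image c).V q) := by
    intro x q hq
    constructor
    · exact fun h => ⟨x, h, rfl⟩
    · rintro ⟨y, hy, e⟩
      exact ((hc y x e).val q hq).1 hy
  induction k generalizing x with
  | zero => exact hval x
  | succ k ih =>
    refine ⟨hval x, fun a ha => ⟨fun x' hx => ?_, ?_⟩⟩
    · exact ⟨c x', ⟨x, x', rfl, rfl, hx⟩, ih (by omega) x'⟩
    · rintro _ ⟨y, y', e, rfl, hy⟩
      obtain ⟨x', hx, hb⟩ := (((hc y x e).mono hk).2 a ha).1 _ hy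
      exact ⟨x', hx, hb.symm.trans (ih (by omega) _)⟩

/-- Monotonicity over finite models implies monotonicity over all models. -/
theorem MonotoneInFin.monotoneIn {A : Type} {φ : MF A} {p : ℕ} (h : MonotoneInFin φ p) :
    MonotoneIn φ p := by
  intro M w hw X hX
  obtain ⟨C, _, c, hc⟩ := exists_finite_coloring (finite_labelsMF φ) (finite_varsMF φ) M
    (depthMF φ)
  obtain ⟨D, _, d, hd⟩ := exists_finite_coloring (finite_labelsMF φ) (finite_varsMF φ)
    (M.update p X) (depthMF φ)
  let e : M.W → C × D := fun x => (c x, d x)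
  have h₁ : Bisim (labelsMF φ) (varsMF φ) M (M.image e) (depthMF φ) w (e w) :=
    bisim_image (fun x y hxy => hc x y (Prod.mk.inj hxy).1) le_rfl w
  have h₂ : Bisim (labelsMF φ) (varsMF φ) (M.update p X) ((M.update p X).image e)
      (depthMF φ) w (e w) :=
    bisim_image (M := M.update p X) (fun x y hxy => hd x y (Prod.mk.inj hxy).2) le_rfl w
  refine (h₂.msat_iff le_rfl subset_rfl subset_rfl).2 ((msat_image_update M e p X _ _).2 ?_)
  exact h (M.image e) (inferInstanceAs (Finite (C × D))) (e w)
    ((h₁.msat_iff le_rfl subset_rfl subset_rfl).1 hw) _ (Set.image_mono hX)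

/-! ### Bounded unravellings with doubled successors -/

section Unravel

variable {A : Type}

/-- The last world of a path from `w`; paths are stored with the most recent step first. -/
def pathEnd {L : Set A} {W : Type} (w : W) : List (L × W × Bool) → W
  | [] => w
  | e :: _ => e.2.1

/-- A list of steps is a path from `w` in `M`. -/
def IsPath {L : Set A} (M : KModel A) (w : M.W) : List (L × M.W × Bool) → Prop
  | [] => True
  | e :: l => M.R e.1 (pathEnd w l) e.2.1 ∧ IsPath M w l

theorem IsPath.of_suffix {L : Set A} {M : KModel A} {w : M.W} {u v : List (L × M.W × Bool)}
    (hv : IsPath M w v) (h : u <:+ v) : IsPath M w u := by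
  induction v with
  | nil => rwa [List.suffix_nil.1 h]
  | cons e v ih =>
    rcases List.suffix_cons_iff.1 h with rfl | h
    · exact hv
    · exact ih hv.2 h

/-- The unravelling of `M` from `w` along the labels in `L` up to depth `n`, in which every
step is available in two copies. -/
def KModel.unravel (M : KModel A) (L : Set A) (n : ℕ) (w : M.W) : KModel A where
  W := {l : List (L × M.W × Bool) // l.length ≤ n ∧ IsPath M w l}
  R a l l' := ∃ e, l'.1 = e :: l.1 ∧ (e.1 : A) = a
  V q := {l | pathEnd w l.1 ∈ M.V q}

variable {L : Set A} {S : Set ℕ} {M N : KModel A} {n : ℕ} {w : M.W} {w' : N.W}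

/-- The root of an unravelling. -/
def unravelRoot (M : KModel A) (L : Set A) (n : ℕ) (w : M.W) : (M.unravel L n w).W :=
  ⟨[], Nat.zero_le _, trivial⟩

theorem finite_unravel (hL : L.Finite) (hM : Finite M.W) : Finite (M.unravel L n w).W := by
  have := hL.to_subtype
  exact ((List.finite_length_le (L × M.W × Bool) n).subset fun _ h => h.1).to_subtype

/-- An unravelling is bisimilar to the original model for any valuation of the former that
is pulled back from the latter. -/
theorem bisim_unravel_of_val {V : ℕ → Set M.W} {V' : ℕ → Set (M.unravel L n w).W}
    (hV : ∀ q l, l ∈ V' q ↔ pathEnd w l.1 ∈ V q) :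
    Bisim L S ⟨(M.unravel L n w).W, (M.unravel L n w).R, V'⟩ ⟨M.W, M.R, V⟩ n
      (unravelRoot M L n w) w := by
  refine Bisim.of_family (M := ⟨(M.unravel L n w).W, (M.unravel L n w).R, V'⟩)
    (N := ⟨M.W, M.R, V⟩)
    (fun k (l : (M.unravel L n w).W) x => pathEnd w l.1 = x ∧ l.1.length + k = n)
    ?_ ?_ ?_ (k := n) (x := unravelRoot M L n w) ⟨rfl, Nat.zero_add n⟩
  · rintro k l _ ⟨rfl, -⟩ q -
    exact hV q l
  · rintro k l _ ⟨rfl, hk⟩ a - l' ⟨e, he, rfl⟩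
    have hp := l'.2.2
    rw [he] at hp
    refine ⟨_, hp.1, ?_, ?_⟩
    · rw [he]; rfl
    · rw [he, List.length_cons]; omega
  · rintro k l _ ⟨rfl, hk⟩ a ha x hx
    exact ⟨⟨(⟨a, ha⟩, x, true) :: l.1, by rw [List.length_cons]; omega, hx, l.2.2⟩,
      ⟨_, rfl, rfl⟩, rfl, by rw [List.length_cons]; omega⟩

theorem bisim_unravel : Bisim L S (M.unravel L n w) M n (unravelRoot M L n w) w :=
  bisim_unravel_of_val fun _ _ => Iff.rfl

theorem bisim_unravel_update (p : ℕ) (X : Set M.W) :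
    Bisim L S ((M.unravel L n w).update p {l | pathEnd w l.1 ∈ X}) (M.update p X) n
      (unravelRoot M L n w) w :=
  bisim_unravel_of_val fun q l => by
    split <;> rfl

/-- Two paths run in parallel: they have the same length and labels, and corresponding
worlds are bisimilar up to the remaining depth. -/
def Parallel (S : Set ℕ) (n : ℕ) (w : M.W) (w' : N.W) (u : List (L × M.W × Bool))
    (v : List (L × N.W × Bool)) : Prop :=
  u.length = v.length ∧ ∀ x y, x <:+ u → y <:+ v → x.length = y.length →
    Bisim L S M N (n - x.length) (pathEnd w x) (pathEnd w' y) ∧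
      x.head?.map Prod.fst = y.head?.map Prod.fst

theorem Parallel.symm {u : List (L × M.W × Bool)} {v : List (L × N.W × Bool)}
    (h : Parallel S n w w' u v) : Parallel S n w' w v u := by
  refine ⟨h.1.symm, fun x y hx hy hl => ?_⟩
  obtain ⟨h₁, h₂⟩ := h.2 y x hy hx hl.symm
  rw [hl]
  exact ⟨h₁.symm, h₂.symm⟩

theorem exists_parallel (h : Bisim L S M N n w w') (v : List (L × N.W × Bool))
    (hv : v.length ≤ n) (hp : IsPath N w' v) :
    ∃ u, IsPath M w u ∧ Parallel S n w w' u v := by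
  induction v with
  | nil =>
    refine ⟨[], trivial, rfl, fun x y hx hy _ => ?_⟩
    rw [List.suffix_nil] at hx hy
    subst hx hy
    exact ⟨h, rfl⟩
  | cons e v ih =>
    rw [List.length_cons] at hv
    obtain ⟨u, hu, hpar⟩ := ih (by omega) hp.2
    have hb := (hpar.2 u v List.suffix_rfl List.suffix_rfl hpar.1).1
    obtain ⟨m, hm⟩ : ∃ m, n - u.length = m + 1 := ⟨n - u.length - 1, by have := hpar.1; omega⟩
    rw [hm] at hb
    obtain ⟨x', hx', hb'⟩ := (hb.2 e.1 e.1.2).2 _ hp.1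
    refine ⟨(e.1, x', e.2.2) :: u, ⟨hx', hu⟩, by simp [hpar.1], fun x y hx hy hl => ?_⟩
    rw [List.suffix_cons_iff] at hx hy
    have hlen := hpar.1
    rcases hx with rfl | hx <;> rcases hy with rfl | hy
    · refine ⟨?_, rfl⟩
      have : n - ((e.1, x', e.2.2) :: u).length = m := by rw [List.length_cons]; omega
      rw [this]
      exact hb'
    · have := hy.length_le
      rw [List.length_cons] at hl
      omega
    · have := hx.length_le
      rw [List.length_cons] at hl
      omega
    · exact hpar.2 x y hx hy hl

/-- The relation between nodes of two unravellings with marked parallel paths `u` and `v`: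
corresponding nodes on the paths, or nodes off the paths that are bisimilar when `p` is
made false. -/
def Linked (S : Set ℕ) (p n : ℕ) (w : M.W) (w' : N.W) (u : List (L × M.W × Bool))
    (v : List (L × N.W × Bool)) (k : ℕ) (x : List (L × M.W × Bool))
    (y : List (L × N.W × Bool)) : Prop :=
  x.length + k = n ∧ y.length + k = n ∧
    ((x <:+ u ∧ y <:+ v) ∨ (¬ x <:+ u ∧ ¬ y <:+ v ∧
      Bisim L S (M.update p ∅) (N.update p ∅) k (pathEnd w x) (pathEnd w' y)))

theorem Linked.symm {p k : ℕ} {u x : List (L × M.W × Bool)} {v y : List (L × N.W × Bool)}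
    (h : Linked S p n w w' u v k x y) : Linked S p n w' w v u k y x :=
  ⟨h.2.1, h.1, h.2.2.imp And.symm fun h => ⟨h.2.1, h.1, h.2.2.symm⟩⟩

theorem Linked.bisim_end {p k : ℕ} {u x : List (L × M.W × Bool)}
    {v y : List (L × N.W × Bool)} (hpar : Parallel S n w w' u v)
    (h : Linked S p n w w' u v k x y) :
    Bisim L S (M.update p ∅) (N.update p ∅) k (pathEnd w x) (pathEnd w' y) := by
  obtain ⟨hx, hy, ⟨h₁, h₂⟩ | ⟨-, -, h⟩⟩ := h
  · have := (hpar.2 x y h₁ h₂ (by omega)).1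
    rw [show n - x.length = k by omega] at this
    exact this.update_empty p
  · exact h

theorem exists_cons_suffix {α : Type*} {y v : List α} (h : y <:+ v)
    (hl : y.length < v.length) : ∃ e, e :: y <:+ v := by
  obtain ⟨t, rfl⟩ := h
  have ht : t ≠ [] := by rintro rfl; simp at hl
  exact ⟨t.getLast ht, t.dropLast, by
    rw [← List.singleton_append, ← List.append_assoc, List.dropLast_append_getLast ht]⟩

/-- One of the two copies of a step avoids a given path. -/
theorem exists_copy_not_suffix {α β : Type*} (a : α) (x : β) (y v : List (α × β × Bool)) :
    ∃ b, ¬ (a, x, b) :: y <:+ v := by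
  by_contra! h
  have := List.suffix_of_suffix_length_le (h true) (h false) (by simp)
  have := this.eq_of_length (by simp)
  simp at this

theorem Linked.forth {p k : ℕ} {u : List (L × M.W × Bool)} {v : List (L × N.W × Bool)}
    (hpar : Parallel S n w w' u v) (hv : IsPath N w' v)
    {x : List (L × M.W × Bool)} {y : List (L × N.W × Bool)} (hy : IsPath N w' y)
    (h : Linked S p n w w' u v (k + 1) x y) (e : L × M.W × Bool)
    (he : IsPath M w (e :: x)) :
    ∃ e' : L × N.W × Bool, e'.1 = e.1 ∧ IsPath N w' (e' :: y) ∧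
      Linked S p n w w' u v k (e :: x) (e' :: y) := by
  have hb := h.bisim_end hpar
  obtain ⟨hxl, hyl, hcase⟩ := h
  have hlen := hpar.1
  by_cases hs : e :: x <:+ u
  · have hx : x <:+ u := (List.suffix_cons e x).trans hs
    have hyv : y <:+ v := by
      rcases hcase with h | h
      · exact h.2
      · exact absurd hx h.1
    have hle := hs.length_le
    rw [List.length_cons] at hle
    obtain ⟨e', he'⟩ := exists_cons_suffix hyv (by omega)
    have hlab := (hpar.2 _ _ hs he' (by simp only [List.length_cons]; omega)).2
    refine ⟨e', by simpa using hlab.symm, hv.of_suffix he', by rw [List.length_cons]; omega,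
      by rw [List.length_cons]; omega, Or.inl ⟨hs, he'⟩⟩
  · obtain ⟨y', hy', hb'⟩ := (hb.2 e.1 e.1.2).1 _ he.1
    obtain ⟨b, hbv⟩ := exists_copy_not_suffix e.1 y' y v
    exact ⟨(e.1, y', b), rfl, ⟨hy', hy⟩, by rw [List.length_cons]; omega,
      by rw [List.length_cons]; omega, Or.inr ⟨hs, hbv, hb'⟩⟩

/-- Marking the ends of parallel paths yields bisimilar unravellings. -/
theorem bisim_unravel_singleton (p : ℕ) (u : (M.unravel L n w).W) (v : (N.unravel L n w').W)
    (hpar : Parallel S n w w' u.1 v.1) :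
    Bisim L S ((M.unravel L n w).update p {u}) ((N.unravel L n w').update p {v}) n
      (unravelRoot M L n w) (unravelRoot N L n w') := by
  refine Bisim.of_family (M := (M.unravel L n w).update p {u})
    (N := (N.unravel L n w').update p {v})
    (fun k (x : (M.unravel L n w).W) (y : (N.unravel L n w').W) =>
      Linked S p n w w' u.1 v.1 k x.1 y.1) ?_ ?_ ?_
    (k := n) (x := unravelRoot M L n w) (y := unravelRoot N L n w')
    ⟨Nat.zero_add n, Nat.zero_add n, Or.inl ⟨List.nil_suffix, List.nil_suffix⟩⟩
  · intro k x y h q hq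
    have hb := (KModel.mem_update _ p q ∅ _).symm.trans
      (((h.bisim_end hpar).val q hq).trans (KModel.mem_update _ p q ∅ _))
    refine (KModel.mem_update _ p q {u} x).trans
      (Iff.trans ?_ (KModel.mem_update _ p q {v} y).symm)
    by_cases hqp : q = p
    · rw [if_pos hqp, if_pos hqp]
      have hlen := hpar.1
      have hx : x.1 = u.1 ↔ x = u := Subtype.ext_iff.symm
      have hy : y.1 = v.1 ↔ y = v := Subtype.ext_iff.symm
      refine hx.symm.trans (Iff.trans ?_ hy)
      obtain ⟨hxl, hyl, ⟨h₁, h₂⟩ | ⟨h₁, h₂, -⟩⟩ := h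
      · constructor
        · intro hxu
          rw [hxu] at hxl
          exact h₂.eq_of_length (by omega)
        · intro hyv
          rw [hyv] at hyl
          exact h₁.eq_of_length (by omega)
      · exact iff_of_false (fun hxu => h₁ (hxu ▸ List.suffix_rfl))
          (fun hyv => h₂ (hyv ▸ List.suffix_rfl))
    · rw [if_neg hqp, if_neg hqp] at hb ⊢
      exact hb
  · rintro k x y h a - x' ⟨e, hx', rfl⟩
    have hp := x'.2.2
    rw [hx'] at hp
    obtain ⟨e', he', hp', hl⟩ := h.forth hpar v.2.2 y.2.2 e hp
    refine ⟨⟨e' :: y.1, by have := hl.2.1; omega, hp'⟩, ⟨e', rfl, by rw [he']⟩, ?_⟩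
    rw [hx']
    exact hl
  · rintro k x y h a - y' ⟨e, hy', rfl⟩
    have hp := y'.2.2
    rw [hy'] at hp
    obtain ⟨e', he', hp', hl⟩ := h.symm.forth hpar.symm u.2.2 x.2.2 e hp
    refine ⟨⟨e' :: x.1, by have := hl.2.1; omega, hp'⟩, ⟨e', rfl, by rw [he']⟩, ?_⟩
    rw [hy']
    exact hl.symm

end Unravel

/-- Complete additivity over finite models implies complete additivity over all models. -/
theorem CompAddFin.compAdd {A : Type} {φ : MF A} {p : ℕ} (h : CompAddFin φ p) :
    CompAdd φ p := by
  have hmono := h.1.monotoneIn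
  refine ⟨hmono, fun M w hw => ?_⟩
  have hL := finite_labelsMF φ
  have hS : (insert p (varsMF φ)).Finite := (finite_varsMF φ).insert p
  have hsub : varsMF φ ⊆ insert p (varsMF φ) := Set.subset_insert _ _
  obtain ⟨C, _, c, hc⟩ := exists_finite_coloring hL hS M (depthMF φ)
  have hMF := bisim_image hc le_rfl w
  have hF := (((hMF.trans bisim_unravel.symm).msat_iff le_rfl subset_rfl hsub).1 hw)
  obtain ⟨v, hvp, hv⟩ := h.2 _
    (finite_unravel hL (M := M.image c) (inferInstanceAs (Finite C))) _ hF
  obtain ⟨u, hu, hpar⟩ := exists_parallel hMF v.1 v.2.1 v.2.2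
  let u' : (M.unravel (labelsMF φ) (depthMF φ) w).W := ⟨u, hpar.1 ▸ v.2.1, hu⟩
  have hsat := ((bisim_unravel_singleton p u' v hpar).msat_iff le_rfl subset_rfl hsub).2 hv
  have hend := (hpar.2 u v.1 List.suffix_rfl List.suffix_rfl hpar.1).1
  refine ⟨pathEnd w u, (hend.val p (Set.mem_insert _ _)).2 hvp, ?_⟩
  have hsat' := hmono _ _ hsat {l | pathEnd w l.1 ∈ ({pathEnd w u} : Set M.W)} (by
    simp only [KModel.update, if_true]
    rintro _ rfl
    rfl)
  exact ((bisim_unravel_update p {pathEnd w u}).msat_iff le_rfl subset_rfl hsub).1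
    ((msat_update_update _ _ _ _ _ _).1 hsat')

/-- A modal formula is completely additive in `p` over finite Kripke models iff
it is completely additive in `p` over all Kripke models. -/
theorem compAddFin_iff_compAdd {A : Type} (φ : MF A) (p : ℕ) :
    CompAddFin φ p ↔ CompAdd φ p := by
  refine ⟨CompAddFin.compAdd, fun h => ⟨fun M _ => h.1 M, fun M _ => h.2 M⟩⟩
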